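/- Let k be a positive integer. For two virtual knots K and K', the following are equivalent: (i) J(K) ≡ J(K') (mod 2k); (ii) K and K' are related by a finite sequence of 2k-moves and Ξ-moves (i.e., some Gauss diagrams representing them are related by a finite sequence of 2k-moves, Ξ-moves and Reidemeister moves). -/

import Mathlib

/-!
Combinatorial Gauss diagrams.

A Gauss diagram is encoded as a list of chord endpoints read along the
oriented circle from a basepoint.  Each endpoint records the (natural number)
label of its chord, whether it is the terminal endpoint of the (oriented)
chord, and the sign of the chord (`true` = +1, `false` = -1).
Diagrams are considered up to rotation of the basepoint and relabeling of the
chords; these renamings are included among the "Reidemeister" generators.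
-/

structure Endpoint where
  label : ℕ
  isTerminal : Bool
  sign : Bool
deriving DecidableEq

namespace Gauss

/-- The sign (±1) of the chord through an endpoint. -/
def signValue (e : Endpoint) : ℤ := if e.sign then 1 else -1

/-- The sign assigned to an endpoint: `ε` at the terminal endpoint and `-ε`
at the initial endpoint of a chord of sign `ε`. -/
def endpointValue (e : Endpoint) : ℤ := if e.isTerminal then signValue e else -signValue e

/-- The list of chord labels of the endpoints of a word. -/
def labels (L : List Endpoint) : List ℕ := L.map Endpoint.label

/-- A word is a Gauss diagram when every chord label occurring in it occurs
exactly twice, once as an initial and once as a terminal endpoint, with the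
same sign at both occurrences. -/
def IsGaussDiagram (L : List Endpoint) : Prop :=
  ∀ e ∈ L, (L.filter (fun x => x.label == e.label)).length = 2 ∧
    ∃ e' ∈ L, e'.label = e.label ∧ e'.isTerminal = !e.isTerminal ∧ e'.sign = e.sign

/-- Rotate a word so that the first endpoint satisfying `p` comes first. -/
def rotateTo (L : List Endpoint) (p : Endpoint → Bool) : List Endpoint :=
  match L.findIdx? p with
  | some i => L.drop i ++ L.take i
  | none => L

/-- The index of the chord labeled `c`: the sum of the signs assigned to the
endpoints on the arc running from the initial endpoint of the chord to its
terminal endpoint in the direction of the circle's orientation. -/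
def chordIndex (L : List Endpoint) (c : ℕ) : ℤ :=
  ((((rotateTo L (fun e => e.label == c && !e.isTerminal)).drop 1).takeWhile
      (fun e => e.label != c)).map endpointValue).sum

/-- `Jn L n`: the sum of the signs of the chords of `L` of index `n`. -/
def Jn (L : List Endpoint) (n : ℤ) : ℤ :=
  ((L.filter (fun e => e.isTerminal && decide (chordIndex L e.label = n))).map signValue).sum

/-- The odd writhe: the sum of the signs of the chords of odd index,
i.e. `J = Σ_{n odd} J_n`. -/
def oddWrithe (L : List Endpoint) : ℤ :=
  ((L.filter (fun e => e.isTerminal && decide (chordIndex L e.label % 2 ≠ 0))).map signValue).sum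

/-- Moving the basepoint of the circle. -/
def rotateStep (L L' : List Endpoint) : Prop :=
  ∃ x xs, L = x :: xs ∧ L' = xs ++ [x]

/-- Injective relabeling of the chords. -/
def relabelStep (L L' : List Endpoint) : Prop :=
  ∃ f : ℕ → ℕ, Function.Injective f ∧
    L' = L.map (fun e => Endpoint.mk (f e.label) e.isTerminal e.sign)

/-- Reidemeister move I (removal direction): remove an isolated chord whose
two endpoints are adjacent (either orientation, either sign). -/
def reid1 (L L' : List Endpoint) : Prop :=
  ∃ (A B : List Endpoint) (c : ℕ) (t s : Bool),
    c ∉ labels (A ++ B) ∧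
    L = A ++ [Endpoint.mk c t s, Endpoint.mk c (!t) s] ++ B ∧
    L' = A ++ B

/-- Reidemeister move II (removal direction): remove two chords of opposite
signs whose initial endpoints are adjacent and whose terminal endpoints are
adjacent (in either of the two admissible orders). -/
def reid2 (L L' : List Endpoint) : Prop :=
  ∃ (A B C : List Endpoint) (c d : ℕ) (s crossed : Bool),
    c ≠ d ∧ c ∉ labels (A ++ B ++ C) ∧ d ∉ labels (A ++ B ++ C) ∧
    L = A ++ [Endpoint.mk c false s, Endpoint.mk d false (!s)] ++ B ++
        (if crossed then [Endpoint.mk c true s, Endpoint.mk d true (!s)]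
         else [Endpoint.mk d true (!s), Endpoint.mk c true s]) ++ C ∧
    L' = A ++ B ++ C

/-- Reidemeister move III (a standard variant; together with the moves I, II,
rotations and relabelings it generates all versions of the third move). -/
def reid3 (L L' : List Endpoint) : Prop :=
  ∃ (A B C D : List Endpoint) (a b c : ℕ) (s : Bool),
    a ≠ b ∧ b ≠ c ∧ a ≠ c ∧
    L = A ++ [Endpoint.mk b false s, Endpoint.mk a false s] ++ B ++
        [Endpoint.mk a true s, Endpoint.mk c false (!s)] ++ C ++
        [Endpoint.mk b true s, Endpoint.mk c true (!s)] ++ D ∧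
    L' = A ++ [Endpoint.mk a false s, Endpoint.mk b false s] ++ B ++
        [Endpoint.mk c false (!s), Endpoint.mk a true s] ++ C ++
        [Endpoint.mk c true (!s), Endpoint.mk b true s] ++ D

/-- A single Reidemeister generator (including diagram renamings). -/
def reidStep (L L' : List Endpoint) : Prop :=
  rotateStep L L' ∨ relabelStep L L' ∨ reid1 L L' ∨ reid2 L L' ∨ reid3 L L'

/-- A Ξ-move: exchange the first and third of three consecutive endpoints
belonging to three distinct chords, keeping all signs and orientations. -/
def xiStep (L L' : List Endpoint) : Prop :=
  ∃ (A B : List Endpoint) (x y z : Endpoint),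
    x.label ≠ y.label ∧ y.label ≠ z.label ∧ x.label ≠ z.label ∧
    L = A ++ [x, y, z] ++ B ∧
    L' = A ++ [z, y, x] ++ B

/-- A 2k-move (removal direction): remove `2k` chords `c 0, …, c (2k-1)`, all
of sign `s`, whose `p`-endpoints appear consecutively on one arc and whose
`q`-endpoints appear consecutively on a disjoint arc, the chord `c i` being
oriented from `p` to `q` for even `i` (the paper's odd `i`, 1-indexed) and
from `q` to `p` for odd `i`, so initial and terminal endpoints alternate. -/
def move2k (k : ℕ) (L L' : List Endpoint) : Prop :=
  ∃ (A B C : List Endpoint) (c : ℕ → ℕ) (s : Bool),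
    (∀ i < 2 * k, ∀ j < 2 * k, c i = c j → i = j) ∧
    (∀ i < 2 * k, c i ∉ labels (A ++ B ++ C)) ∧
    L = A ++ (List.range (2 * k)).map (fun i => Endpoint.mk (c i) (decide (i % 2 = 1)) s)
          ++ B ++
        (List.range (2 * k)).map (fun i => Endpoint.mk (c i) (decide (i % 2 = 0)) s)
          ++ C ∧
    L' = A ++ B ++ C

/-- A crossing change: reverse the sign and the orientation of one chord. -/
def crossingChange (L L' : List Endpoint) : Prop :=
  ∃ c : ℕ,
    L' = L.map (fun e =>
      if e.label = c then Endpoint.mk e.label (!e.isTerminal) (!e.sign) else e)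

/-- Finite sequences of moves from `r`, performed in either direction. -/
def Moves (r : List Endpoint → List Endpoint → Prop) :
    List Endpoint → List Endpoint → Prop :=
  Relation.ReflTransGen (fun L L' => r L L' ∨ r L' L)

/-- Related by Reidemeister moves: the two words represent the same virtual knot. -/
def ReidEquiv : List Endpoint → List Endpoint → Prop := Moves reidStep

/-- Related by a finite sequence of 2k-moves (and Reidemeister moves). -/
def Rel2k (k : ℕ) : List Endpoint → List Endpoint → Prop :=
  Moves (fun L L' => reidStep L L' ∨ move2k k L L')

/-- Related by a finite sequence of Ξ-moves (and Reidemeister moves). -/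
def RelXi : List Endpoint → List Endpoint → Prop :=
  Moves (fun L L' => reidStep L L' ∨ xiStep L L')

/-- Related by a finite sequence of 2k-moves and Ξ-moves (and Reidemeister moves). -/
def Rel2kXi (k : ℕ) : List Endpoint → List Endpoint → Prop :=
  Moves (fun L L' => reidStep L L' ∨ move2k k L L' ∨ xiStep L L')

/-- Related by a finite sequence of crossing changes and Ξ-moves
(and Reidemeister moves). -/
def RelCCXi : List Endpoint → List Endpoint → Prop :=
  Moves (fun L L' => reidStep L L' ∨ crossingChange L L' ∨ xiStep L L')

/-- A shell-pair of sign `s`: two chords `c`, `d` of sign `s` whose four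
endpoints are consecutive, interleaved as 1st-3rd and 2nd-4th
(with arbitrary orientations `t`, `u` of the two shells). -/
def shellPair (c d : ℕ) (t u s : Bool) : List Endpoint :=
  [Endpoint.mk c t s, Endpoint.mk d u s, Endpoint.mk c (!t) s, Endpoint.mk d (!u) s]

/-- The Gauss diagram `G(a)`: `|a|` consecutive shell-pairs of sign `+1` if
`a > 0` and of sign `-1` if `a < 0`; `G(0)` has no chords.  It represents the
virtual knot `K(a)`. -/
def Gword (a : ℤ) : List Endpoint :=
  ((List.range a.natAbs).map
    (fun j => shellPair (2 * j) (2 * j + 1) false false (decide (0 < a)))).flatten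

/-- `Rel2kCount k m G G'`: `G` and `G'` are related by a finite sequence of
Reidemeister moves and exactly `m` 2k-moves. -/
inductive Rel2kCount (k : ℕ) : ℕ → List Endpoint → List Endpoint → Prop
  | refl (L : List Endpoint) : Rel2kCount k 0 L L
  | reid {m : ℕ} {L L' L'' : List Endpoint} :
      reidStep L L' ∨ reidStep L' L →
      Rel2kCount k m L' L'' → Rel2kCount k m L L''
  | move {m : ℕ} {L L' L'' : List Endpoint} :
      move2k k L L' ∨ move2k k L' L →
      Rel2kCount k m L' L'' → Rel2kCount k (m + 1) L L''

/-- The 2k-move distance: the minimal number of 2k-moves needed to relate the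
two diagrams (together with Reidemeister moves). -/
noncomputable def dist2k (k : ℕ) (L L' : List Endpoint) : ℕ :=
  sInf {m | Rel2kCount k m L L'}

/-- The other endpoint of the chord of `e`. -/
def mate (e : Endpoint) : Endpoint := ⟨e.label, !e.isTerminal, e.sign⟩

@[simp] theorem mate_label (e : Endpoint) : (mate e).label = e.label := rfl
@[simp] theorem mate_sign (e : Endpoint) : (mate e).sign = e.sign := rfl
@[simp] theorem mate_term (e : Endpoint) : (mate e).isTerminal = !e.isTerminal := rfl
@[simp] theorem mate_mate (e : Endpoint) : mate (mate e) = e := by simp [mate]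
theorem ne_mate (e : Endpoint) : e ≠ mate e := by
  intro h
  have := congrArg Endpoint.isTerminal h
  simp at this

theorem eq_mate_of {e e' : Endpoint} (h1 : e'.label = e.label)
    (h2 : e'.isTerminal = !e.isTerminal) (h3 : e'.sign = e.sign) : e' = mate e := by
  cases e'; simp_all [mate]

/-- Endpoints in positions of a given parity (`true`: positions 0, 2, 4, ...). -/
def sel : Bool → List Endpoint → Multiset Endpoint
  | _, [] => 0
  | true, a :: l => a ::ₘ sel false l
  | false, _ :: l => sel true l

/-- Parity of the length. -/
def odd : List Endpoint → Bool
  | [] => false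
  | _ :: l => !odd l

@[simp] theorem sel_nil (b : Bool) : sel b [] = 0 := by cases b <;> rfl
@[simp] theorem sel_true_cons (a : Endpoint) (l) : sel true (a :: l) = a ::ₘ sel false l := rfl
@[simp] theorem sel_false_cons (a : Endpoint) (l) : sel false (a :: l) = sel true l := rfl
@[simp] theorem odd_nil : odd [] = false := rfl
@[simp] theorem odd_cons (a : Endpoint) (l) : odd (a :: l) = !odd l := rfl

@[simp] theorem odd_append (A B : List Endpoint) : odd (A ++ B) = (odd A ^^ odd B) := by
  induction A with
  | nil => simp
  | cons a l ih => simp [ih]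

theorem sel_append (b : Bool) (A B : List Endpoint) :
    sel b (A ++ B) = sel b A + sel (b ^^ odd A) B := by
  induction A generalizing b with
  | nil => simp
  | cons a l ih => cases b <;> simp [ih]

theorem sel_add (b : Bool) (L : List Endpoint) : sel b L + sel (!b) L = (L : Multiset Endpoint) := by
  induction L generalizing b with
  | nil => simp
  | cons a l ih =>
    rw [← Multiset.cons_coe]
    cases b
    · have := ih true
      simp at this
      simp [this]
    · have := ih false
      simp at this
      simp [this]

theorem mem_of_sel {b : Bool} {L : List Endpoint} {e : Endpoint} (h : e ∈ sel b L) : e ∈ L := by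
  have : e ∈ sel b L + sel (!b) L := Multiset.mem_add.2 (Or.inl h)
  rw [sel_add] at this
  simpa using this

theorem mem_sel_or {L : List Endpoint} {e : Endpoint} (b : Bool) (h : e ∈ L) :
    e ∈ sel b L ∨ e ∈ sel (!b) L := by
  rw [← Multiset.mem_add, sel_add]; simpa using h

theorem odd_iff (L : List Endpoint) : odd L = true ↔ L.length % 2 = 1 := by
  induction L with
  | nil => simp
  | cons a l ih =>
    simp only [odd_cons, List.length_cons]
    cases h : odd l <;> simp_all <;> omega

theorem sel_card (L : List Endpoint) : (sel true L).card = (sel false L).card + (odd L).toNat := by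
  induction L with
  | nil => simp
  | cons a l ih =>
    simp
    rw [ih]; cases odd l <;> simp

theorem sel_map (f : Endpoint → Endpoint) (b : Bool) (L : List Endpoint) :
    sel b (L.map f) = (sel b L).map f := by
  induction L generalizing b with
  | nil => simp
  | cons a l ih => cases b <;> simp [ih]

/-- Gauss diagram condition on the multiset of endpoints. -/
def GaussM (M : Multiset Endpoint) : Prop :=
  ∀ e ∈ M, M.filter (fun x => x.label = e.label) = {e, mate e}

theorem gauss_iff (L : List Endpoint) : IsGaussDiagram L ↔ GaussM (L : Multiset Endpoint) := by
  have key : ∀ e : Endpoint, (L.filter (fun x => x.label == e.label)).length =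
      (Multiset.filter (fun x => x.label = e.label) (L : Multiset Endpoint)).card := by
    intro e
    rw [Multiset.filter_coe, Multiset.coe_card]
    rfl
  constructor
  · intro h e he
    obtain ⟨h1, e', he', h2, h3, h4⟩ := h e (by simpa using he)
    rw [key] at h1
    obtain rfl := eq_mate_of h2 h3 h4
    symm
    apply Multiset.eq_of_le_of_card_le
    · rw [Multiset.le_iff_subset]
      · intro x hx
        simp at hx
        rcases hx with rfl | rfl <;> simp_all
      · simp [ne_mate]
    · rw [h1]; simp
  · intro h e he
    have h1 := h e (by simpa using he)
    rw [key, h1]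
    refine ⟨by simp, mate e, ?_, rfl, rfl, rfl⟩
    have : mate e ∈ Multiset.filter (fun x => x.label = e.label) (L : Multiset Endpoint) := by
      rw [h1]; simp
    simpa using (Multiset.mem_filter.1 this).1

theorem GaussM.mate_mem {M : Multiset Endpoint} (h : GaussM M) {e} (he : e ∈ M) : mate e ∈ M := by
  have : mate e ∈ Multiset.filter (fun x => x.label = e.label) M := by
    rw [h e he]; simp
  exact (Multiset.mem_filter.1 this).1

theorem GaussM.eq_or {M : Multiset Endpoint} (h : GaussM M) {e x} (he : e ∈ M) (hx : x ∈ M)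
    (hl : x.label = e.label) : x = e ∨ x = mate e := by
  have : x ∈ Multiset.filter (fun x => x.label = e.label) M := Multiset.mem_filter.2 ⟨hx, hl⟩
  rw [h e he] at this
  simpa using this

theorem GaussM.nodup {M : Multiset Endpoint} (h : GaussM M) : M.Nodup := by
  rw [Multiset.nodup_iff_count_le_one]
  intro a
  by_cases ha : a ∈ M
  · have : (Multiset.filter (fun x => x.label = a.label) M).count a = M.count a :=
      Multiset.count_filter_of_pos (p := fun x : Endpoint => x.label = a.label) rfl
    rw [← this, h a ha]
    have : ({a, mate a} : Multiset Endpoint).Nodup := by simp [ne_mate]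
    exact Multiset.nodup_iff_count_le_one.1 this a
  · simp [Multiset.count_eq_zero_of_notMem ha]

/-- Two multisets of endpoints share no chord. -/
def LD (M N : Multiset Endpoint) : Prop := ∀ x ∈ M, ∀ y ∈ N, x.label ≠ y.label

theorem LD.symm {M N} (h : LD M N) : LD N M := fun x hx y hy e => h y hy x hx e.symm

theorem LD.mono {M N M' N'} (h : LD M N) (h1 : M' ⊆ M) (h2 : N' ⊆ N) : LD M' N' :=
  fun x hx y hy => h x (h1 hx) y (h2 hy)

theorem gaussM_add {M N : Multiset Endpoint} (h : LD M N) :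
    GaussM (M + N) ↔ GaussM M ∧ GaussM N := by
  have z1 : ∀ e ∈ M, N.filter (fun x => x.label = e.label) = 0 := fun e he =>
    Multiset.filter_eq_nil.2 fun y hy hh => h e he y hy hh.symm
  have z2 : ∀ e ∈ N, M.filter (fun x => x.label = e.label) = 0 := fun e he =>
    Multiset.filter_eq_nil.2 fun y hy hh => h y hy e he hh
  constructor
  · intro H
    refine ⟨fun e he => ?_, fun e he => ?_⟩
    · have := H e (Multiset.mem_add.2 (Or.inl he))
      rwa [Multiset.filter_add, z1 e he, add_zero] at this
    · have := H e (Multiset.mem_add.2 (Or.inr he))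
      rwa [Multiset.filter_add, z2 e he, zero_add] at this
  · rintro ⟨H1, H2⟩ e he
    rw [Multiset.filter_add]
    rcases Multiset.mem_add.1 he with he | he
    · rw [z1 e he, H1 e he, add_zero]
    · rw [z2 e he, H2 e he, zero_add]

theorem gaussM_chord (e : Endpoint) : GaussM {e, mate e} := by
  intro x hx
  simp at hx
  rcases hx with rfl | rfl
  · rw [Multiset.filter_eq_self.2]
    intro a ha; simp at ha; rcases ha with rfl | rfl <;> rfl
  · rw [Multiset.filter_eq_self.2, mate_mate, Multiset.pair_comm]
    intro a ha; simp at ha; rcases ha with rfl | rfl <;> rfl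

theorem GaussM.even {L : List Endpoint} (h : GaussM (L : Multiset Endpoint)) : odd L = false := by
  by_contra hc
  have h1 : L.length % 2 = 1 := (odd_iff L).1 (by simpa using hc)
  have h2 : ∑ a ∈ (labels L).toFinset, (labels L).count a = (labels L).length :=
    List.sum_toFinset_count_eq_length (labels L)
  have h3 : ∀ a ∈ (labels L).toFinset, (labels L).count a = 2 := by
    intro a ha
    simp [labels] at ha
    obtain ⟨e, he, rfl⟩ := ha
    have := congrArg Multiset.card (h e (by simpa using he))
    rw [Multiset.filter_coe, Multiset.coe_card] at this
    rw [labels, List.count, List.countP_map, List.countP_eq_length_filter]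
    exact this
  rw [Finset.sum_congr rfl h3] at h2
  simp [labels] at h2
  omega

/-- Contribution to the odd writhe of one parity class. -/
def JM (M : Multiset Endpoint) : ℤ :=
  ((M.filter (fun e => e.isTerminal = true ∧ mate e ∈ M)).map signValue).sum

theorem JM_add {M N : Multiset Endpoint} (h : LD M N) : JM (M + N) = JM M + JM N := by
  unfold JM
  rw [Multiset.filter_add, Multiset.map_add, Multiset.sum_add]
  congr 3
  · apply Multiset.filter_congr
    intro x hx
    simp only [Multiset.mem_add, and_congr_right_iff]
    intro _
    constructor
    · rintro (h1 | h1)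
      · exact h1
      · exact absurd (mate_label x).symm (h x hx _ h1)
    · exact Or.inl
  · apply Multiset.filter_congr
    intro x hx
    simp only [Multiset.mem_add, and_congr_right_iff]
    intro _
    constructor
    · rintro (h1 | h1)
      · exact absurd (mate_label x) (h _ h1 x hx)
      · exact h1
    · exact Or.inr

@[simp] theorem JM_zero : JM 0 = 0 := by simp [JM]

/-- Odd writhe via parity classes. -/
def J2 (L : List Endpoint) : ℤ := JM (sel true L) + JM (sel false L)

theorem J2_eq (b : Bool) (L : List Endpoint) : J2 L = JM (sel b L) + JM (sel (!b) L) := by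
  cases b <;> simp [J2, add_comm]

theorem exists_split2 {L : List Endpoint} {x y : Endpoint} (hx : x ∈ L) (hy : y ∈ L) (h : x ≠ y) :
    ∃ A B C, L = A ++ x :: (B ++ y :: C) ∨ L = A ++ y :: (B ++ x :: C) := by
  obtain ⟨A, B, rfl⟩ := List.append_of_mem hx
  simp [h.symm] at hy
  rcases hy with hy | hy
  · obtain ⟨A1, A2, rfl⟩ := List.append_of_mem hy
    exact ⟨A1, A2, B, Or.inr (by simp)⟩
  · obtain ⟨A1, A2, rfl⟩ := List.append_of_mem hy
    exact ⟨A, A1, A2, Or.inl rfl⟩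

/-- In a Gauss diagram containing a chord, the rest has other labels. -/
theorem GaussM.rest {N : Multiset Endpoint} {x : Endpoint}
    (h : GaussM (x ::ₘ mate x ::ₘ N)) : ∀ y ∈ N, y.label ≠ x.label := by
  intro y hy hl
  have h1 := h x (by simp)
  rw [Multiset.filter_cons_of_pos _ (by rfl), Multiset.filter_cons_of_pos _ (by rfl)] at h1
  have h2 := congrArg Multiset.card h1
  simp at h2
  have := h2 y hy
  exact this hl

theorem takeWhile_all {c : ℕ} {B C : List Endpoint} {e : Endpoint} (hB : ∀ y ∈ B, y.label ≠ c)
    (he : e.label = c) : (B ++ e :: C).takeWhile (fun x => x.label != c) = B := by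
  induction B with
  | nil => simp [he]
  | cons a l ih =>
    simp at hB
    simp [hB.1, ih hB.2]

theorem findIdx_at {A C : List Endpoint} {e : Endpoint} {p : Endpoint → Bool}
    (hA : ∀ y ∈ A, p y = false) (he : p e = true) :
    (A ++ e :: C).findIdx? p = some A.length := by
  induction A with
  | nil => simp [List.findIdx?_cons, he]
  | cons a l ih =>
    simp at hA
    simp [List.findIdx?_cons, hA.1, ih hA.2]

theorem rotateTo_at {A C : List Endpoint} {e : Endpoint} {p : Endpoint → Bool}
    (hA : ∀ y ∈ A, p y = false) (he : p e = true) :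
    rotateTo (A ++ e :: C) p = e :: C ++ A := by
  simp [rotateTo, findIdx_at hA he]

theorem sum_parity (B : List Endpoint) :
    ((B.map endpointValue).sum % 2 ≠ 0) ↔ odd B = true := by
  induction B with
  | nil => simp
  | cons a l ih =>
    simp only [List.map_cons, List.sum_cons, odd_cons]
    have : endpointValue a = 1 ∨ endpointValue a = -1 := by
      unfold endpointValue signValue; split <;> split <;> simp
    cases h : odd l <;> simp [h] at ih ⊢ <;> omega

theorem chordIndex_parity {L : List Endpoint} (hL : GaussM (L : Multiset Endpoint)) {e : Endpoint}
    (b : Bool) (he : e ∈ sel b L) (ht : e.isTerminal = true) :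
    chordIndex L e.label % 2 ≠ 0 ↔ mate e ∈ sel b L := by
  have heL := mem_of_sel he
  have hmL : mate e ∈ L := by simpa using hL.mate_mem (e := e) (by simpa using heL)
  have hev := hL.even
  obtain ⟨A, B, C, rfl | rfl⟩ := exists_split2 hmL heL (ne_mate e).symm
  · have hr : ∀ y ∈ A ++ B ++ C, y.label ≠ e.label := by
      have := GaussM.rest (N := ((A ++ B ++ C : List Endpoint) : Multiset Endpoint)) (x := e) (by
        convert hL using 1
        rw [Multiset.cons_coe, Multiset.cons_coe, Multiset.coe_eq_coe]
        rw [List.perm_iff_count]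
        intro a; simp [List.count_cons]; omega)
      simpa using this
    have hA : ∀ y ∈ A, y.label ≠ e.label := fun y hy => hr y (by simp [hy])
    have hB : ∀ y ∈ B, y.label ≠ e.label := fun y hy => hr y (by simp [hy])
    have hC : ∀ y ∈ C, y.label ≠ e.label := fun y hy => hr y (by simp [hy])
    have n : ∀ X : List Endpoint, (∀ y ∈ X, y.label ≠ e.label) → ∀ b, e ∉ sel b X ∧ mate e ∉ sel b X :=
      fun X hX b => ⟨fun h => hX _ (mem_of_sel h) rfl, fun h => hX _ (mem_of_sel h) rfl⟩
    have hci : chordIndex (A ++ mate e :: (B ++ e :: C)) e.label = (B.map endpointValue).sum := by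
      unfold chordIndex
      rw [rotateTo_at]
      · simp only [List.cons_append, List.drop_succ_cons, List.drop_zero, List.append_assoc]
        rw [takeWhile_all hB rfl]
      · intro y hy; simp [hA y hy]
      · simp [ht]
    rw [hci, sum_parity]
    simp only [sel_append, Multiset.mem_add, (n A hA _).1, (n A hA _).2, false_or] at he ⊢
    generalize (b ^^ odd A) = b' at *
    cases b' <;> simp [sel_append, n A hA, n B hB, n C hC, ne_mate] at he ⊢ <;>
      cases hB : odd B <;> simp [hB, n C hC, (ne_mate e).symm, ne_mate] at he ⊢
  · have hr : ∀ y ∈ A ++ B ++ C, y.label ≠ e.label := by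
      have := GaussM.rest (N := ((A ++ B ++ C : List Endpoint) : Multiset Endpoint)) (x := e) (by
        convert hL using 1
        rw [Multiset.cons_coe, Multiset.cons_coe, Multiset.coe_eq_coe]
        rw [List.perm_iff_count]
        intro a; simp [List.count_cons]; omega)
      simpa using this
    have hA : ∀ y ∈ A, y.label ≠ e.label := fun y hy => hr y (by simp [hy])
    have hB : ∀ y ∈ B, y.label ≠ e.label := fun y hy => hr y (by simp [hy])
    have hC : ∀ y ∈ C, y.label ≠ e.label := fun y hy => hr y (by simp [hy])
    have n : ∀ X : List Endpoint, (∀ y ∈ X, y.label ≠ e.label) → ∀ b, e ∉ sel b X ∧ mate e ∉ sel b X :=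
      fun X hX b => ⟨fun h => hX _ (mem_of_sel h) rfl, fun h => hX _ (mem_of_sel h) rfl⟩
    have hci : chordIndex (A ++ e :: (B ++ mate e :: C)) e.label = ((C ++ A).map endpointValue).sum := by
      unfold chordIndex
      rw [show A ++ e :: (B ++ mate e :: C) = (A ++ e :: B) ++ mate e :: C by simp, rotateTo_at]
      · simp only [List.cons_append, List.drop_succ_cons, List.drop_zero]
        rw [← List.append_assoc, takeWhile_all (by
          intro y hy; rcases List.mem_append.1 hy with h | h
          · exact hC y h
          · exact hA y h) rfl]
      · intro y hy
        simp at hy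
        rcases hy with hy | rfl | hy
        · simp [hA y hy]
        · simp [ht]
        · simp [hB y hy]
      · simp [ht]
    rw [hci, sum_parity]
    have hpar : odd (C ++ A) = odd B := by
      simp at hev ⊢
      cases h1 : odd A <;> cases h2 : odd B <;> cases h3 : odd C <;> simp [h1, h2, h3] at hev ⊢
    rw [hpar]
    simp only [sel_append, Multiset.mem_add, (n A hA _).1, (n A hA _).2, false_or] at he ⊢
    generalize (b ^^ odd A) = b' at *
    cases b' <;> simp [sel_append, n A hA, n B hB, n C hC, ne_mate] at he ⊢ <;>
      cases hB : odd B <;> simp [hB, n C hC, (ne_mate e).symm, ne_mate] at he ⊢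

theorem oddWrithe_eq {L : List Endpoint} (hL : GaussM (L : Multiset Endpoint)) :
    oddWrithe L = J2 L := by
  have h1 : oddWrithe L = (((L : Multiset Endpoint).filter
      (fun e => e.isTerminal = true ∧ chordIndex L e.label % 2 ≠ 0)).map signValue).sum := by
    unfold oddWrithe
    rw [Multiset.filter_coe, Multiset.map_coe, Multiset.sum_coe]
    congr 3
    funext e
    simp
  rw [h1, ← sel_add true L, Multiset.filter_add, Multiset.map_add, Multiset.sum_add, J2]
  unfold JM
  congr 3
  · apply Multiset.filter_congr
    intro x hx
    simp only [and_congr_right_iff]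
    exact fun ht => chordIndex_parity hL _ hx ht
  · apply Multiset.filter_congr
    intro x hx
    simp only [and_congr_right_iff]
    exact fun ht => chordIndex_parity hL _ hx ht

/-- The sign as an integer. -/
def sg (s : Bool) : ℤ := if s then 1 else -1

theorem JM_single (x : Endpoint) : JM {x} = 0 := by
  have : mate x ≠ x := (ne_mate x).symm
  simp [JM, Multiset.filter_singleton, this]

theorem JM_pair_ne {x y : Endpoint} (h : x.label ≠ y.label) : JM {x, y} = 0 := by
  have : ({x, y} : Multiset Endpoint) = {x} + {y} := rfl
  rw [this, JM_add, JM_single, JM_single, add_zero]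
  intro a ha b hb
  simp at ha hb
  subst ha hb; exact h

theorem JM_chord (x : Endpoint) : JM {x, mate x} = sg x.sign := by
  obtain ⟨c, t, s⟩ := x
  cases t <;> simp [JM, mate, Multiset.filter_cons, Multiset.filter_singleton, signValue, sg]

theorem JM_chord' (x : Endpoint) : JM {mate x, x} = sg x.sign := by
  rw [Multiset.pair_comm, JM_chord]

theorem J2_split {L : List Endpoint} (f g : Bool → Multiset Endpoint)
    (h : ∀ b, sel b L = f b + g b) (hd : ∀ b, LD (f b) (g b)) :
    J2 L = (JM (f true) + JM (f false)) + (JM (g true) + JM (g false)) := by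
  rw [J2, h, h, JM_add (hd _), JM_add (hd _)]; ring

theorem sel_sub (b : Bool) (L : List Endpoint) : sel b L ⊆ (L : Multiset Endpoint) := by
  intro x hx; simpa using mem_of_sel hx

theorem sel_xor (f : Bool → ℤ) (a : Bool) : f (true ^^ a) + f (false ^^ a) = f true + f false := by
  cases a <;> simp [add_comm]

theorem coe_add' (A B : List Endpoint) :
    ((A ++ B : List Endpoint) : Multiset Endpoint) = (A : Multiset Endpoint) + B := rfl

theorem notMem_labels {c : ℕ} {L : List Endpoint} (h : c ∉ labels L) : ∀ y ∈ L, y.label ≠ c := by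
  intro y hy e
  exact h (List.mem_map.2 ⟨y, hy, e⟩)

/-- The invariance statement for a step. -/
def Inv (k : ℕ) (L L' : List Endpoint) : Prop :=
  (GaussM (L : Multiset Endpoint) ↔ GaussM (L' : Multiset Endpoint)) ∧
  (GaussM (L : Multiset Endpoint) → J2 L ≡ J2 L' [ZMOD (2 * k : ℤ)])

theorem inv_rotate {k : ℕ} {L L' : List Endpoint} (h : rotateStep L L') : Inv k L L' := by
  obtain ⟨x, xs, rfl, rfl⟩ := h
  have hp : ((x :: xs : List Endpoint) : Multiset Endpoint) = ((xs ++ [x] : List Endpoint) : Multiset Endpoint) := by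
    rw [coe_add', add_comm]; rfl
  refine ⟨by rw [hp], fun hL => ?_⟩
  have he := hL.even
  simp at he
  simp [J2, sel_append, he]
  rw [add_comm, add_comm (sel false xs)]
  exact Int.ModEq.refl _

/-- Relabel an endpoint. -/
def rl (f : ℕ → ℕ) (e : Endpoint) : Endpoint := ⟨f e.label, e.isTerminal, e.sign⟩

theorem rl_inj {f : ℕ → ℕ} (hf : Function.Injective f) : Function.Injective (rl f) := by
  rintro ⟨a, b, c⟩ ⟨a', b', c'⟩ h
  simp [rl] at h
  simp [hf h.1, h.2]

theorem rl_mate (f : ℕ → ℕ) (e : Endpoint) : mate (rl f e) = rl f (mate e) := rfl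

theorem gaussM_map {f : ℕ → ℕ} (hf : Function.Injective f) (M : Multiset Endpoint) :
    GaussM (M.map (rl f)) ↔ GaussM M := by
  unfold GaussM
  simp only [Multiset.mem_map, forall_exists_index, and_imp, forall_apply_eq_imp_iff₂]
  refine forall₂_congr fun e he => ?_
  rw [Multiset.filter_map]
  have : ((fun x : Endpoint => x.label = (rl f e).label) ∘ rl f) = fun x => x.label = e.label := by
    funext x
    simp [rl, hf.eq_iff]
  simp only [this]
  rw [rl_mate, show ({rl f e, rl f (mate e)} : Multiset Endpoint) = Multiset.map (rl f) {e, mate e} by simp]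
  exact (Multiset.map_injective (rl_inj hf)).eq_iff

theorem JM_map {f : ℕ → ℕ} (hf : Function.Injective f) (M : Multiset Endpoint) :
    JM (M.map (rl f)) = JM M := by
  unfold JM
  rw [Multiset.filter_map, Multiset.map_map]
  congr 2
  apply Multiset.filter_congr
  intro x hx
  simp only [Function.comp, rl_mate]
  rw [Multiset.mem_map_of_injective (rl_inj hf)]
  rfl

theorem inv_relabel {k : ℕ} {L L' : List Endpoint} (h : relabelStep L L') : Inv k L L' := by
  obtain ⟨f, hf, rfl⟩ := h
  change Inv k L (L.map (rl f))
  refine ⟨?_, fun hL => ?_⟩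
  · rw [← Multiset.map_coe, gaussM_map hf]
  · rw [J2, J2, sel_map, sel_map, JM_map hf, JM_map hf]

theorem inv_reid1 {k : ℕ} {L L' : List Endpoint} (h : reid1 L L') : Inv k L L' := by
  obtain ⟨A, B, c, t, s, hc, rfl, rfl⟩ := h
  have hc := notMem_labels hc
  set x : Endpoint := ⟨c, t, s⟩ with hx
  change Inv k (A ++ [x, mate x] ++ B) _
  have hd : LD ((A ++ B : List Endpoint) : Multiset Endpoint) {x, mate x} := by
    intro y hy z hz
    simp at hz
    have := hc y (by simpa using hy)
    rcases hz with rfl | rfl <;> simpa [hx] using this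
  refine ⟨?_, fun _ => ?_⟩
  · have : ((A ++ [x, mate x] ++ B : List Endpoint) : Multiset Endpoint) =
      ((A ++ B : List Endpoint) : Multiset Endpoint) + {x, mate x} := by
      simp only [coe_add']
      rw [add_right_comm]; rfl
    rw [this, gaussM_add hd]
    exact ⟨fun h => h.1, fun h => ⟨h, gaussM_chord x⟩⟩
  · rw [J2_split (fun b => sel b (A ++ B)) (fun b => sel (b ^^ odd A) [x, mate x])]
    · rw [sel_xor (fun b => JM (sel b [x, mate x]))]
      simp only [sel_true_cons, sel_false_cons, sel_nil, Multiset.cons_zero, JM_single]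
      simp [J2, Int.ModEq.refl]
    · intro b
      simp only [sel_append, odd_append, odd_cons, odd_nil, Bool.not_false, Bool.not_true, Bool.xor_false, Bool.xor_assoc]
      abel
    · intro b
      exact hd.mono (sel_sub _ _) (sel_sub _ _)

theorem inv_reid2 {k : ℕ} {L L' : List Endpoint} (h : reid2 L L') : Inv k L L' := by
  obtain ⟨A, B, C, c, d, s, cr, hcd, hc, hd, rfl, rfl⟩ := h
  have hc := notMem_labels hc
  have hd := notMem_labels hd
  set x : Endpoint := ⟨c, false, s⟩ with hx
  set y : Endpoint := ⟨d, false, !s⟩ with hy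
  have hxy : x.label ≠ y.label := hcd
  change Inv k (A ++ [x, y] ++ B ++ (if cr = true then [mate x, mate y] else [mate y, mate x]) ++ C) _
  set Y := (if cr = true then [mate x, mate y] else [mate y, mate x]) with hY
  have hYM : (Y : Multiset Endpoint) = {mate x, mate y} := by
    rw [hY]; cases cr
    · exact Multiset.pair_comm _ _
    · rfl
  have oY : odd Y = false := by rw [hY]; cases cr <;> rfl
  have hD : LD ((A ++ B ++ C : List Endpoint) : Multiset Endpoint) ({x, mate x} + {y, mate y}) := by
    intro w hw z hz
    simp at hz
    have h1 := hc w (by simpa using hw)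
    have h2 := hd w (by simpa using hw)
    rcases hz with rfl | rfl | rfl | rfl
    all_goals first | exact h1 | exact h2
  have hE : (([x, y] : List Endpoint) : Multiset Endpoint) + (Y : Multiset Endpoint) =
      {x, mate x} + {y, mate y} := by
    rw [hYM]
    change (({x} + {y}) + ({mate x} + {mate y}) : Multiset Endpoint) = ({x} + {mate x}) + ({y} + {mate y})
    abel
  refine ⟨?_, fun _ => ?_⟩
  · have : ((A ++ [x, y] ++ B ++ Y ++ C : List Endpoint) : Multiset Endpoint) =
      ((A ++ B ++ C : List Endpoint) : Multiset Endpoint) + ({x, mate x} + {y, mate y}) := by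
      rw [← hE]
      simp only [coe_add']
      abel
    rw [this, gaussM_add hD, gaussM_add]
    · exact ⟨fun h => h.1, fun h => ⟨h, gaussM_chord x, gaussM_chord y⟩⟩
    · intro z hz w hw
      simp at hz hw
      rcases hz with rfl | rfl <;> rcases hw with rfl | rfl <;> simpa using hxy
  · rw [J2_split (fun b => sel b (A ++ B ++ C))
      (fun b => sel (b ^^ odd A) [x, y] + sel ((b ^^ odd A) ^^ odd B) Y)]
    · rw [sel_xor (fun b => JM (sel b [x, y] + sel (b ^^ odd B) Y))]
      have : JM (sel true [x, y] + sel (true ^^ odd B) Y) + JM (sel false [x, y] + sel (false ^^ odd B) Y) = 0 := by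
        have e1 : JM ({x} + {mate x}) = sg s := JM_chord x
        have e2 : JM ({y} + {mate y}) = sg (!s) := JM_chord y
        have e3 : JM ({x} + {mate y}) = 0 := JM_pair_ne (by simpa using hxy)
        have e4 : JM ({y} + {mate x}) = 0 := JM_pair_ne (by simpa using hxy.symm)
        have e5 : sg s + sg (!s) = 0 := by cases s <;> rfl
        have e6 : sg (!s) + sg s = 0 := by cases s <;> rfl
        rw [hY]
        cases cr <;> cases odd B <;>
          simp only [if_true, if_false, Bool.false_eq_true, Bool.xor_false, Bool.xor_true, Bool.not_true,
            Bool.not_false, sel_true_cons, sel_false_cons, sel_nil, Multiset.cons_zero,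
            e1, e2, e3, e4, e5, e6, add_zero]
      rw [this]
      simp [J2, Int.ModEq.refl]
    · intro b
      simp only [sel_append, odd_append, odd_cons, odd_nil, Bool.not_false, Bool.not_true, Bool.xor_false, Bool.xor_assoc, oY]
      abel
    · intro b
      refine hD.mono (sel_sub _ _) ?_
      rw [← hE]
      intro z hz
      rcases Multiset.mem_add.1 hz with h | h
      · exact Multiset.mem_add.2 (Or.inl (sel_sub _ _ h))
      · exact Multiset.mem_add.2 (Or.inr (sel_sub _ _ h))

theorem inv_reid3 {k : ℕ} {L L' : List Endpoint} (h : reid3 L L') : Inv k L L' := by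
  obtain ⟨A, B, C, D, a, b, c, s, hab, hbc, hac, rfl, rfl⟩ := h
  set a0 : Endpoint := ⟨a, false, s⟩ with ha0
  set b0 : Endpoint := ⟨b, false, s⟩ with hb0
  set c0 : Endpoint := ⟨c, false, !s⟩ with hc0
  change Inv k (A ++ [b0, a0] ++ B ++ [mate a0, c0] ++ C ++ [mate b0, mate c0] ++ D)
    (A ++ [a0, b0] ++ B ++ [c0, mate a0] ++ C ++ [mate c0, mate b0] ++ D)
  have hsw : ∀ x y : Endpoint, (([x, y] : List Endpoint) : Multiset Endpoint) = ([y, x] : List Endpoint) :=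
    fun x y => Multiset.pair_comm x y
  constructor
  · have : ((A ++ [b0, a0] ++ B ++ [mate a0, c0] ++ C ++ [mate b0, mate c0] ++ D : List Endpoint) : Multiset Endpoint)
      = ((A ++ [a0, b0] ++ B ++ [c0, mate a0] ++ C ++ [mate c0, mate b0] ++ D : List Endpoint) : Multiset Endpoint) := by
      simp only [coe_add']
      rw [hsw a0, hsw c0, hsw (mate c0)]
    rw [this]
  · intro hG
    let N : Multiset Endpoint := {b0, a0} + {mate a0, c0} + {mate b0, mate c0}
    let M : Multiset Endpoint := (A : Multiset Endpoint) + B + C + D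
    have hMN : ((A ++ [b0, a0] ++ B ++ [mate a0, c0] ++ C ++ [mate b0, mate c0] ++ D : List Endpoint) : Multiset Endpoint) = M + N := by
      simp only [coe_add']
      change (A : Multiset Endpoint) + {b0, a0} + B + {mate a0, c0} + C + {mate b0, mate c0} + D = _
      simp only [M, N]
      abel
    rw [hMN] at hG
    have hr : ∀ (x : Endpoint) (N' : Multiset Endpoint), N = {x} + {mate x} + N' → ∀ w ∈ M, w.label ≠ x.label := by
      intro x N' hN w hw
      rw [hN] at hG
      refine GaussM.rest (N := M + N') (x := x) ?_ w (Multiset.mem_add.2 (Or.inl hw))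
      convert hG using 1
      rw [← Multiset.singleton_add, ← Multiset.singleton_add]
      abel
    have ra := hr a0 ({b0} + {c0} + {mate b0} + {mate c0}) (by
      change (({b0} + {a0}) + ({mate a0} + {c0}) + ({mate b0} + {mate c0}) : Multiset Endpoint) = _
      abel)
    have rb := hr b0 ({a0} + {c0} + {mate a0} + {mate c0}) (by
      change (({b0} + {a0}) + ({mate a0} + {c0}) + ({mate b0} + {mate c0}) : Multiset Endpoint) = _
      abel)
    have rc := hr c0 ({b0} + {a0} + {mate b0} + {mate a0}) (by
      change (({b0} + {a0}) + ({mate a0} + {c0}) + ({mate b0} + {mate c0}) : Multiset Endpoint) = _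
      abel)
    have hD : LD M N := by
      intro w hw z hz
      simp [N] at hz
      rcases hz with rfl | rfl | rfl | rfl | rfl | rfl
      all_goals first | exact ra w hw | exact rb w hw | exact rc w hw
    let f : Bool → Multiset Endpoint := fun b => sel b (A ++ B ++ C ++ D)
    let g : Bool → Multiset Endpoint := fun b => sel (b ^^ odd A) [b0, a0] +
      sel (b ^^ odd A ^^ odd B) [mate a0, c0] + sel (b ^^ odd A ^^ odd B ^^ odd C) [mate b0, mate c0]
    have hsel : ∀ b (x y : Endpoint), sel b [x, y] = sel (!b) [y, x] := by
      intro b x y; cases b <;> rfl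
    have hf : ∀ b, f b ⊆ M := fun b => sel_sub b _
    have hg : ∀ b, g b ⊆ N := by
      intro b z hz
      simp only [g, Multiset.mem_add] at hz
      simp only [N, Multiset.mem_add]
      rcases hz with (h | h) | h
      · exact Or.inl (Or.inl (sel_sub _ _ h))
      · exact Or.inl (Or.inr (sel_sub _ _ h))
      · exact Or.inr (sel_sub _ _ h)
    rw [J2_split f g, J2_split f (fun b => g (!b))]
    · simp only [Bool.not_true, Bool.not_false]
      rw [add_comm (JM (g true))]
    · intro b
      simp only [f, g]
      simp only [sel_append, odd_append, odd_cons, odd_nil, Bool.not_false, Bool.not_true, Bool.xor_false, Bool.xor_assoc, Bool.not_xor]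
      rw [hsel _ a0, hsel _ c0 (mate a0), hsel _ (mate c0)]
      abel
    · intro b
      exact hD.mono (hf b) (hg _)
    · intro b
      simp only [f, g]
      simp only [sel_append, odd_append, odd_cons, odd_nil, Bool.not_false, Bool.not_true, Bool.xor_false, Bool.xor_assoc]
      abel
    · intro b
      exact hD.mono (hf b) (hg _)

theorem inv_xi {k : ℕ} {L L' : List Endpoint} (h : xiStep L L') : Inv k L L' := by
  obtain ⟨A, B, x, y, z, -, -, -, rfl, rfl⟩ := h
  have : ∀ b, sel b (A ++ [x, y, z] ++ B) = sel b (A ++ [z, y, x] ++ B) := by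
    intro b
    have : ∀ b, sel b [x, y, z] = sel b [z, y, x] := by
      intro b; cases b
      · rfl
      · exact Multiset.pair_comm _ _
    simp only [sel_append, this, odd_append, odd_cons]
  constructor
  · rw [← sel_add true, ← sel_add true (A ++ [z, y, x] ++ B), this, this]
  · intro _
    rw [J2, J2, this, this]

/-- The two blocks of a 2k-move. -/
def blkP (c : ℕ → ℕ) (s : Bool) (n : ℕ) : List Endpoint :=
  (List.range n).map (fun i => Endpoint.mk (c i) (decide (i % 2 = 1)) s)
def blkQ (c : ℕ → ℕ) (s : Bool) (n : ℕ) : List Endpoint :=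
  (List.range n).map (fun i => Endpoint.mk (c i) (decide (i % 2 = 0)) s)

theorem odd_congr {A B : List Endpoint} (h : A.length = B.length) : odd A = odd B := by
  rw [Bool.eq_iff_iff, odd_iff, odd_iff, h]

theorem blk_lab {c : ℕ → ℕ} {s : Bool} {n : ℕ} {z : Endpoint}
    (hz : z ∈ (blkP c s n : Multiset Endpoint) + (blkQ c s n : Multiset Endpoint)) :
    ∃ i < n, z.label = c i := by
  simp [blkP, blkQ] at hz
  rcases hz with ⟨i, hi, rfl⟩ | ⟨i, hi, rfl⟩ <;> exact ⟨i, hi, rfl⟩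

theorem blk_main (c : ℕ → ℕ) (s : Bool) (n : ℕ)
    (hc : ∀ i < n, ∀ j < n, c i = c j → i = j) (β : Bool) :
    GaussM ((blkP c s n : Multiset Endpoint) + (blkQ c s n : Multiset Endpoint)) ∧
    JM (sel true (blkP c s n) + sel (true ^^ β) (blkQ c s n)) +
    JM (sel false (blkP c s n) + sel (false ^^ β) (blkQ c s n)) = if β then 0 else n * sg s := by
  induction n with
  | zero => simp [blkP, blkQ, GaussM]
  | succ n ih =>
    obtain ⟨ih1, ih2⟩ := ih (fun i hi j hj => hc i (by omega) j (by omega))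
    set p : Endpoint := ⟨c n, decide (n % 2 = 1), s⟩ with hp
    have hq : (⟨c n, decide (n % 2 = 0), s⟩ : Endpoint) = mate p := by
      simp only [hp, mate, Endpoint.mk.injEq, true_and, and_true]
      rcases Nat.mod_two_eq_zero_or_one n with h | h <;> simp [h]
    have eP : blkP c s (n + 1) = blkP c s n ++ [p] := by simp [blkP, List.range_succ, hp]
    have eQ : blkQ c s (n + 1) = blkQ c s n ++ [mate p] := by simp [blkQ, List.range_succ, hq]
    have ho : odd (blkQ c s n) = odd (blkP c s n) := odd_congr (by simp [blkP, blkQ])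
    have hD : LD ((blkP c s n : Multiset Endpoint) + (blkQ c s n : Multiset Endpoint)) ({p} + {mate p}) := by
      intro x hx y hy hl
      obtain ⟨i, hi, hx⟩ := blk_lab hx
      have hy : y.label = c n := by
        simp at hy; rcases hy with rfl | rfl <;> rfl
      rw [hx, hy] at hl
      have := hc i (by omega) n (by omega) hl
      omega
    rw [eP, eQ]
    constructor
    · have : ((blkP c s n ++ [p] : List Endpoint) : Multiset Endpoint) + ((blkQ c s n ++ [mate p] : List Endpoint) : Multiset Endpoint)
        = ((blkP c s n : Multiset Endpoint) + (blkQ c s n : Multiset Endpoint)) + ({p} + {mate p}) := by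
        simp only [coe_add', Multiset.coe_singleton]
        abel
      rw [this, gaussM_add hD]
      exact ⟨ih1, gaussM_chord p⟩
    · have hJ : ∀ b, JM (sel b (blkP c s n ++ [p]) + sel (b ^^ β) (blkQ c s n ++ [mate p])) =
          JM (sel b (blkP c s n) + sel (b ^^ β) (blkQ c s n)) +
          JM (sel (b ^^ odd (blkP c s n)) [p] + sel ((b ^^ odd (blkP c s n)) ^^ β) [mate p]) := by
        intro b
        rw [← JM_add]
        · congr 1
          rw [sel_append, sel_append, ho, show ((b ^^ β) ^^ odd (blkP c s n)) = ((b ^^ odd (blkP c s n)) ^^ β) by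
            cases b <;> cases β <;> simp]
          abel
        · refine hD.mono ?_ ?_
          · intro z hz
            rcases Multiset.mem_add.1 hz with h | h
            · exact Multiset.mem_add.2 (Or.inl (sel_sub _ _ h))
            · exact Multiset.mem_add.2 (Or.inr (sel_sub _ _ h))
          · intro z hz
            rcases Multiset.mem_add.1 hz with h | h
            · exact Multiset.mem_add.2 (Or.inl (sel_sub _ _ h))
            · exact Multiset.mem_add.2 (Or.inr (sel_sub _ _ h))
      rw [hJ, hJ]
      have h2 := sel_xor (fun b => JM (sel b [p] + sel (b ^^ β) [mate p])) (odd (blkP c s n))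
      have h3 : JM (sel true [p] + sel (true ^^ β) [mate p]) + JM (sel false [p] + sel (false ^^ β) [mate p])
          = if β then 0 else sg s := by
        have e1 : JM ({p} + {mate p}) = sg s := JM_chord p
        cases β <;> simp only [if_true, if_false, Bool.false_eq_true, Bool.xor_false, Bool.xor_true,
          Bool.not_true, Bool.not_false, sel_true_cons, sel_false_cons, sel_nil, Multiset.cons_zero,
          e1, JM_single, JM_zero, add_zero, zero_add]
      rw [add_add_add_comm, h2, h3, ih2]
      cases β <;> simp; ring

theorem move2k_main {k : ℕ} (A B C : List Endpoint) (c : ℕ → ℕ) (s : Bool)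
    (hc : ∀ i < 2 * k, ∀ j < 2 * k, c i = c j → i = j)
    (hl : ∀ i < 2 * k, c i ∉ labels (A ++ B ++ C)) :
    (GaussM ((A ++ blkP c s (2 * k) ++ B ++ blkQ c s (2 * k) ++ C : List Endpoint) : Multiset Endpoint) ↔
      GaussM ((A ++ B ++ C : List Endpoint) : Multiset Endpoint)) ∧
    J2 (A ++ blkP c s (2 * k) ++ B ++ blkQ c s (2 * k) ++ C) =
      J2 (A ++ B ++ C) + if odd B then 0 else (2 * k) * sg s := by
  have hm := blk_main c s (2 * k) hc (odd B)
  have oP : odd (blkP c s (2 * k)) = false := by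
    rw [← Bool.not_eq_true, odd_iff]; simp [blkP]
  have oQ : odd (blkQ c s (2 * k)) = false := by
    rw [← Bool.not_eq_true, odd_iff]; simp [blkQ]
  have hD : LD ((A ++ B ++ C : List Endpoint) : Multiset Endpoint)
      ((blkP c s (2 * k) : Multiset Endpoint) + (blkQ c s (2 * k) : Multiset Endpoint)) := by
    intro x hx y hy
    obtain ⟨i, hi, hy⟩ := blk_lab hy
    rw [hy]
    exact notMem_labels (hl i hi) x (by simpa using hx)
  set P := blkP c s (2 * k)
  set Q := blkQ c s (2 * k)
  constructor
  · have : ((A ++ P ++ B ++ Q ++ C : List Endpoint) : Multiset Endpoint) =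
      ((A ++ B ++ C : List Endpoint) : Multiset Endpoint) + ((P : Multiset Endpoint) + Q) := by
      simp only [coe_add']
      abel
    rw [this, gaussM_add hD]
    exact ⟨fun h => h.1, fun h => ⟨h, hm.1⟩⟩
  · rw [J2_split (fun b => sel b (A ++ B ++ C))
      (fun b => sel (b ^^ odd A) P + sel ((b ^^ odd A) ^^ odd B) Q)]
    · rw [sel_xor (fun b => JM (sel b P + sel (b ^^ odd B) Q)), hm.2]
      simp [J2]
    · intro b
      simp only [sel_append, odd_append, odd_cons, odd_nil, Bool.not_false, Bool.not_true, Bool.xor_false, Bool.xor_assoc, oP, oQ]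
      abel
    · intro b
      refine hD.mono (sel_sub _ _) ?_
      intro z hz
      rcases Multiset.mem_add.1 hz with h | h
      · exact Multiset.mem_add.2 (Or.inl (sel_sub _ _ h))
      · exact Multiset.mem_add.2 (Or.inr (sel_sub _ _ h))

theorem inv_move2k {k : ℕ} {L L' : List Endpoint} (h : move2k k L L') : Inv k L L' := by
  obtain ⟨A, B, C, c, s, hc, hl, rfl, rfl⟩ := h
  obtain ⟨h1, h2⟩ := move2k_main A B C c s hc hl
  refine ⟨h1, fun _ => ?_⟩
  change J2 (A ++ blkP c s (2 * k) ++ B ++ blkQ c s (2 * k) ++ C) ≡ _ [ZMOD _]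
  rw [h2]
  split
  · simp [Int.ModEq.refl]
  · exact Int.modEq_iff_dvd.2 ⟨-sg s, by ring⟩

theorem Inv.symm {k : ℕ} {L L' : List Endpoint} (h : Inv k L L') : Inv k L' L :=
  ⟨h.1.symm, fun hL => (h.2 (h.1.2 hL)).symm⟩

theorem inv_rel {k : ℕ} {L L' : List Endpoint} (h : Rel2kXi k L L') : Inv k L L' := by
  have step : ∀ {L L' : List Endpoint}, (reidStep L L' ∨ move2k k L L' ∨ xiStep L L') → Inv k L L' := by
    rintro L L' ((h | h | h | h | h) | h | h)
    · exact inv_rotate h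
    · exact inv_relabel h
    · exact inv_reid1 h
    · exact inv_reid2 h
    · exact inv_reid3 h
    · exact inv_move2k h
    · exact inv_xi h
  induction h with
  | refl => exact ⟨Iff.rfl, fun _ => Int.ModEq.refl _⟩
  | tail _ h ih =>
    have : Inv k _ _ := h.elim step (fun h => (step h).symm)
    exact ⟨ih.1.trans this.1, fun hL => (ih.2 hL).trans (this.2 (ih.1.1 hL))⟩

theorem rel_symm {k : ℕ} {L L' : List Endpoint} (h : Rel2kXi k L L') : Rel2kXi k L' L := by
  unfold Rel2kXi Moves at *
  induction h with
  | refl => exact Relation.ReflTransGen.refl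
  | tail _ h ih => exact Relation.ReflTransGen.head h.symm ih

theorem rel_trans {k : ℕ} {L L' L'' : List Endpoint} (h : Rel2kXi k L L') (h' : Rel2kXi k L' L'') :
    Rel2kXi k L L'' := Relation.ReflTransGen.trans h h'

theorem rel_refl {k : ℕ} (L : List Endpoint) : Rel2kXi k L L := Relation.ReflTransGen.refl

theorem rel_of_reid {k : ℕ} {L L' : List Endpoint} (h : reidStep L L') : Rel2kXi k L L' :=
  Relation.ReflTransGen.single (Or.inl (Or.inl h))

theorem rel_rot {k : ℕ} (A B : List Endpoint) : Rel2kXi k (A ++ B) (B ++ A) := by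
  induction A generalizing B with
  | nil => simpa using rel_refl B
  | cons a l ih =>
    refine rel_trans (rel_of_reid (Or.inl ⟨a, l ++ B, rfl, rfl⟩)) ?_
    have := ih (B ++ [a])
    simpa using this

theorem rel_r1 {k : ℕ} {A B : List Endpoint} {x : Endpoint} (h : ∀ y ∈ A ++ B, y.label ≠ x.label) :
    Rel2kXi k (A ++ [x, mate x] ++ B) (A ++ B) := by
  refine rel_of_reid (Or.inr (Or.inr (Or.inl ⟨A, B, x.label, x.isTerminal, x.sign, ?_, rfl, rfl⟩)))
  intro hm
  obtain ⟨y, hy, e⟩ := List.mem_map.1 hm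
  exact h y hy e

theorem rest_list {M : Multiset Endpoint} (hM : GaussM M) {x : Endpoint} {N : List Endpoint}
    (h : M = ((x :: mate x :: N : List Endpoint) : Multiset Endpoint)) :
    ∀ y ∈ N, y.label ≠ x.label := by
  intro y hy
  refine GaussM.rest (N := (N : Multiset Endpoint)) ?_ y (by simpa using hy)
  rw [h] at hM
  exact hM

theorem mset_eq {A B : List Endpoint} (h : ∀ a, A.count a = B.count a) :
    (A : Multiset Endpoint) = B := by
  rw [Multiset.coe_eq_coe, List.perm_iff_count]; exact h

theorem GaussM.mate_of {M : Multiset Endpoint} (hM : GaussM M) {x y : Endpoint} (hx : x ∈ M) {N : List Endpoint}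
    (h : M = ((x :: y :: N : List Endpoint) : Multiset Endpoint)) (hl : y.label = x.label) : y = mate x := by
  rcases hM.eq_or hx (x := y) (by rw [h]; simp) hl with e | e
  · subst e
    have := hM.nodup
    rw [h] at this
    simp at this
  · exact e

/-- Swaps at distance two of endpoints of different chords. -/
theorem good_swap {k : ℕ} {A B : List Endpoint} {x y z : Endpoint}
    (hG : GaussM ((A ++ [x, y, z] ++ B : List Endpoint) : Multiset Endpoint))
    (hxz : x.label ≠ z.label) :
    Rel2kXi k (A ++ [x, y, z] ++ B) (A ++ [z, y, x] ++ B) := by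
  have hx : x ∈ ((A ++ [x, y, z] ++ B : List Endpoint) : Multiset Endpoint) := by simp
  have hz : z ∈ ((A ++ [x, y, z] ++ B : List Endpoint) : Multiset Endpoint) := by simp
  by_cases hxy : y.label = x.label
  · have e1 : ((A ++ [x, y, z] ++ B : List Endpoint) : Multiset Endpoint) =
      ((x :: y :: (A ++ z :: B) : List Endpoint) : Multiset Endpoint) :=
      mset_eq (by intro a; simp [List.count_cons]; omega)
    obtain rfl := hG.mate_of hx e1 hxy
    have hr := rest_list hG e1
    have s1 : Rel2kXi k (A ++ [x, mate x] ++ (z :: B)) (A ++ (z :: B)) := rel_r1 hr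
    have s2 : Rel2kXi k ((A ++ [z]) ++ [mate x, mate (mate x)] ++ B) ((A ++ [z]) ++ B) :=
      rel_r1 (by simpa using hr)
    have := rel_trans s1 (by simpa using rel_symm s2)
    simpa using this
  · by_cases hyz : y.label = z.label
    · have e1 : ((A ++ [x, y, z] ++ B : List Endpoint) : Multiset Endpoint) =
        ((z :: y :: (A ++ x :: B) : List Endpoint) : Multiset Endpoint) :=
        mset_eq (by intro a; simp [List.count_cons]; omega)
      obtain rfl := hG.mate_of hz e1 hyz
      have hr := rest_list hG e1
      have s1 : Rel2kXi k (A ++ [z, mate z] ++ (x :: B)) (A ++ (x :: B)) := rel_r1 hr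
      have s2 : Rel2kXi k ((A ++ [x]) ++ [mate z, mate (mate z)] ++ B) ((A ++ [x]) ++ B) :=
        rel_r1 (by simpa using hr)
      have := rel_trans s1 (by simpa using rel_symm s2)
      simpa using rel_symm this
    · exact Relation.ReflTransGen.single (Or.inl (Or.inr (Or.inr
        ⟨A, B, x, y, z, fun e => hxy e.symm, hyz, hxz, rfl, rfl⟩)))

theorem slide {k : ℕ} {x u : Endpoint} (n : ℕ) : ∀ (A W B : List Endpoint), W.length = 2 * n →
    (∀ w ∈ W, w.label ≠ x.label) → (∀ w ∈ W, w.label ≠ u.label) →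
    GaussM ((A ++ W ++ [x, u] ++ B : List Endpoint) : Multiset Endpoint) →
    Rel2kXi k (A ++ W ++ [x, u] ++ B) (A ++ [x, u] ++ W ++ B) := by
  induction n with
  | zero =>
    intro A W B hW _ _ _
    have : W = [] := List.length_eq_zero_iff.1 (by omega)
    subst this
    simpa using rel_refl _
  | succ n ih =>
    intro A W B hW hx hu hG
    match W, hW with
    | w1 :: w2 :: W, hW =>
      simp at hx hu
      have s1 : Rel2kXi k ((A ++ [w1, w2]) ++ W ++ [x, u] ++ B) ((A ++ [w1, w2]) ++ [x, u] ++ W ++ B) :=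
        ih (A ++ [w1, w2]) W B (by simp at hW; omega) hx.2.2 hu.2.2 (by simpa using hG)
      have s2 : Rel2kXi k (A ++ [w1, w2, x] ++ (u :: W ++ B)) (A ++ [x, w2, w1] ++ (u :: W ++ B)) := by
        apply good_swap
        · convert hG using 1
          exact mset_eq (by intro a; simp [List.count_cons]; omega)
        · exact hx.1
      have s3 : Rel2kXi k ((A ++ [x]) ++ [w2, w1, u] ++ (W ++ B)) ((A ++ [x]) ++ [u, w1, w2] ++ (W ++ B)) := by
        apply good_swap
        · convert hG using 1
          exact mset_eq (by intro a; simp [List.count_cons]; omega)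
        · exact hu.2.1
      have := rel_trans (rel_trans (by simpa using s1) (by simpa using s2)) (by simpa using s3)
      simpa using this

theorem exists_fresh (L : List Endpoint) : ∃ N : ℕ, ∀ y ∈ L, y.label < N := by
  induction L with
  | nil => exact ⟨0, by simp⟩
  | cons a l ih =>
    obtain ⟨N, hN⟩ := ih
    refine ⟨max N (a.label + 1), fun y hy => ?_⟩
    rcases List.mem_cons.1 hy with rfl | h
    · omega
    · have := hN y h
      omega

theorem flip_head {k : ℕ} {W : List Endpoint} {x y : Endpoint}
    (hG : GaussM (([x, y, mate x] ++ W : List Endpoint) : Multiset Endpoint)) :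
    Rel2kXi k ([x, y, mate x] ++ W) ([mate x, y, x] ++ W) := by
  have hr := rest_list (N := y :: W) (x := x) hG (mset_eq (by intro a; simp [List.count_cons]; omega))
  have hev := hG.even
  match W, hG, hev, hr with
  | w :: W, hG, hev, hr =>
    have hlen : ∃ n, W.length = 2 * n := by
      have : odd W = false := by simpa using hev
      have : ¬ (W.length % 2 = 1) := by rw [← odd_iff]; simp [this]
      exact ⟨W.length / 2, by omega⟩
    obtain ⟨n, hn⟩ := hlen
    obtain ⟨N, hN⟩ := exists_fresh ([x, y, mate x] ++ w :: W)
    let u : Endpoint := ⟨N, true, true⟩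
    have hu : ∀ v ∈ [x, y, mate x] ++ w :: W, v.label ≠ u.label := fun v hv => (hN v hv).ne
    have hG' : GaussM ((u :: mate u :: ([x, y, mate x] ++ w :: W) : List Endpoint) : Multiset Endpoint) := by
      have : ((u :: mate u :: ([x, y, mate x] ++ w :: W) : List Endpoint) : Multiset Endpoint) =
        {u, mate u} + (([x, y, mate x] ++ w :: W : List Endpoint) : Multiset Endpoint) := rfl
      rw [this, gaussM_add]
      · exact ⟨gaussM_chord u, hG⟩
      · intro p hp q hq
        simp only [Multiset.insert_eq_cons, Multiset.mem_cons, Multiset.mem_singleton] at hp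
        have := hu q (by simpa using hq)
        rcases hp with rfl | rfl <;> exact this.symm
    simp only [List.cons_append, List.nil_append, List.mem_cons, forall_eq_or_imp] at hr hu
    obtain ⟨hux, huy, -, huw, huW⟩ := hu
    have s1 : Rel2kXi k ([x] ++ [u, mate u] ++ ([y, mate x, w] ++ W)) ([x] ++ ([y, mate x, w] ++ W)) := by
      apply rel_r1
      intro v hv
      simp only [List.cons_append, List.nil_append, List.mem_cons] at hv
      rcases hv with rfl | rfl | rfl | rfl | hv
      · exact hux
      · exact huy
      · exact hux
      · exact huw
      · exact huW v hv
    have s2 : Rel2kXi k ([x, u] ++ ([mate u, y, mate x, w] ++ W)) (([mate u, y, mate x, w] ++ W) ++ [x, u]) :=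
      rel_rot _ _
    have s3 : Rel2kXi k ([mate u, y, mate x, w] ++ W ++ [x, u] ++ []) ([mate u, y, mate x, w] ++ [x, u] ++ W ++ []) := by
      apply slide n _ _ _ hn (fun v hv => hr.2.2 v hv) huW
      convert hG' using 1
      exact mset_eq (by intro a; simp [List.count_cons]; omega)
    have s4 : Rel2kXi k ([mate u, y, mate x] ++ [w, x, u] ++ W) ([mate u, y, mate x] ++ [u, x, w] ++ W) := by
      apply good_swap _ huw
      convert hG' using 1
      exact mset_eq (by intro a; simp [List.count_cons]; omega)
    have s5 : Rel2kXi k ([mate u] ++ [y, mate x, u] ++ ([x, w] ++ W)) ([mate u] ++ [u, mate x, y] ++ ([x, w] ++ W)) := by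
      apply good_swap _ huy
      convert hG' using 1
      exact mset_eq (by intro a; simp [List.count_cons]; omega)
    have s6 : Rel2kXi k ([] ++ [mate u, mate (mate u)] ++ ([mate x, y, x, w] ++ W)) ([] ++ ([mate x, y, x, w] ++ W)) := by
      apply rel_r1
      intro v hv
      simp only [List.cons_append, List.nil_append, List.mem_cons] at hv
      rcases hv with rfl | rfl | rfl | rfl | hv
      · exact hux
      · exact huy
      · exact hux
      · exact huw
      · exact huW v hv
    rw [mate_mate] at s6
    simp only [List.cons_append, List.nil_append, List.append_nil] at *
    exact rel_trans (rel_symm s1) (rel_trans s2 (rel_trans s3 (rel_trans s4 (rel_trans s5 s6))))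

/-- Arbitrary swaps at distance two. -/
theorem gen_swap {k : ℕ} {A B : List Endpoint} {x y z : Endpoint}
    (hG : GaussM ((A ++ [x, y, z] ++ B : List Endpoint) : Multiset Endpoint)) :
    Rel2kXi k (A ++ [x, y, z] ++ B) (A ++ [z, y, x] ++ B) := by
  by_cases hxz : z.label = x.label
  · have hx : x ∈ ((A ++ [x, y, z] ++ B : List Endpoint) : Multiset Endpoint) := by simp
    have e1 : ((A ++ [x, y, z] ++ B : List Endpoint) : Multiset Endpoint) =
        ((x :: z :: (A ++ y :: B) : List Endpoint) : Multiset Endpoint) :=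
        mset_eq (by intro a; simp [List.count_cons]; omega)
    obtain rfl := hG.mate_of hx e1 hxz
    have s1 : Rel2kXi k (A ++ ([x, y, mate x] ++ B)) (([x, y, mate x] ++ B) ++ A) := rel_rot _ _
    have s2 : Rel2kXi k ([x, y, mate x] ++ (B ++ A)) ([mate x, y, x] ++ (B ++ A)) := by
      apply flip_head
      convert hG using 1
      exact mset_eq (by intro a; simp [List.count_cons]; omega)
    have s3 : Rel2kXi k (([mate x, y, x] ++ B) ++ A) (A ++ ([mate x, y, x] ++ B)) := rel_rot _ _
    have := rel_trans s1 (rel_trans (by simpa using s2) s3)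
    simpa using this
  · exact good_swap hG (fun e => hxz e.symm)

/-- Sequences of swaps at distance two. -/
inductive Sw : List Endpoint → List Endpoint → Prop
  | refl (L) : Sw L L
  | step (A B : List Endpoint) (x y z : Endpoint) (L : List Endpoint) :
      Sw L (A ++ [x, y, z] ++ B) → Sw L (A ++ [z, y, x] ++ B)

theorem Sw.trans {L L' L'' : List Endpoint} (h : Sw L L') (h' : Sw L' L'') : Sw L L'' := by
  induction h' with
  | refl => exact h
  | step A B x y z L _ ih => exact Sw.step A B x y z _ (ih h)

theorem Sw.cons {L L' : List Endpoint} (a : Endpoint) (h : Sw L L') : Sw (a :: L) (a :: L') := by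
  induction h with
  | refl => exact Sw.refl _
  | step A B x y z L _ ih => exact Sw.step (a :: A) B x y z _ ih

theorem Sw.sel_eq {L L' : List Endpoint} (h : Sw L L') (b : Bool) : sel b L = sel b L' := by
  induction h with
  | refl => rfl
  | step A B x y z L _ ih =>
    rw [ih]
    have : ∀ b, sel b [x, y, z] = sel b [z, y, x] := by
      intro b; cases b
      · rfl
      · exact Multiset.pair_comm _ _
    simp only [sel_append, this, odd_append, odd_cons]

theorem Sw.rel {k : ℕ} {L L' : List Endpoint} (h : Sw L L') (hG : GaussM (L : Multiset Endpoint)) :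
    Rel2kXi k L L' := by
  induction h with
  | refl => exact rel_refl _
  | step A B x y z L h ih =>
    refine rel_trans (ih hG) (gen_swap ?_)
    rwa [← sel_add true, ← h.sel_eq, ← h.sel_eq, sel_add]

theorem Sw.front (n : ℕ) : ∀ {L : List Endpoint} {a : Endpoint}, L.length ≤ n → a ∈ sel true L →
    ∃ l, Sw L (a :: l) := by
  induction n using Nat.strong_induction_on with
  | _ n ih =>
    intro L a hn ha
    match L with
    | [] => simp at ha
    | [x] =>
      simp at ha
      subst ha
      exact ⟨[], Sw.refl _⟩
    | x :: y :: r =>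
      simp at ha hn
      rcases ha with rfl | ha
      · exact ⟨y :: r, Sw.refl _⟩
      · obtain ⟨l, hl⟩ := ih (n - 2) (by omega) (L := r) (by omega) ha
        have := (hl.cons y).cons x
        exact ⟨y :: x :: l, Sw.step [] l x y a _ this⟩

theorem Sw.of_sel {L L' : List Endpoint} (h : ∀ b, sel b L = sel b L') : Sw L L' := by
  induction L' generalizing L with
  | nil =>
    have : (L : Multiset Endpoint) = 0 := by rw [← sel_add true, h, h]; simp
    have : L = [] := by simpa using this
    subst this
    exact Sw.refl _
  | cons a l' ih =>
    have ha : a ∈ sel true L := by rw [h]; simp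
    obtain ⟨l, hl⟩ := Sw.front L.length le_rfl ha
    refine hl.trans (Sw.cons a (ih ?_))
    intro b
    have h1 := (hl.sel_eq (!b)).symm.trans (h (!b))
    cases b
    · simpa using h1
    · simpa using h1

theorem Sw.coe_eq {L L' : List Endpoint} (h : Sw L L') :
    (L : Multiset Endpoint) = (L' : Multiset Endpoint) := by
  rw [← sel_add true L, ← sel_add true L', h.sel_eq, h.sel_eq]

theorem Sw.front' {L : List Endpoint} {a : Endpoint} (ha : a ∈ sel true L) :
    ∃ l, Sw L (a :: l) ∧ sel true l = sel false L ∧ a ::ₘ sel false l = sel true L := by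
  obtain ⟨l, hl⟩ := Sw.front L.length le_rfl ha
  exact ⟨l, hl, (hl.sel_eq false).symm, (hl.sel_eq true).symm⟩

/-- Reduced diagrams: all chords odd and of the same sign. -/
def Red (L : List Endpoint) : Prop :=
  (∀ b, ∀ e ∈ sel b L, mate e ∈ sel b L) ∧ ∃ s : Bool, ∀ e ∈ L, e.sign = s

theorem sel_nonempty {L : List Endpoint} (hG : GaussM (L : Multiset Endpoint)) (hL : L ≠ []) :
    (∃ e, e ∈ sel true L) ∧ ∃ e, e ∈ sel false L := by
  have hc := sel_card L
  rw [hG.even] at hc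
  have h1 : (sel true L).card ≠ 0 := by
    intro h
    have h3 : (L : Multiset Endpoint).card = 0 := by
      rw [← sel_add true L, Multiset.card_add]; simp_all
    exact hL (by simpa using h3)
  refine ⟨Multiset.card_pos_iff_exists_mem.1 (by omega), Multiset.card_pos_iff_exists_mem.1 ?_⟩
  simp at hc; omega

theorem reduce (k n : ℕ) : ∀ L : List Endpoint, L.length ≤ n → GaussM (L : Multiset Endpoint) →
    ∃ L', Rel2kXi k L L' ∧ GaussM (L' : Multiset Endpoint) ∧ Red L' := by
  induction n using Nat.strong_induction_on with
  | _ n ih =>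
  intro L hn hG
  by_cases h1 : ∀ b, ∀ e ∈ sel b L, mate e ∈ sel b L
  · by_cases h2 : ∃ e ∈ sel true L, ∃ f ∈ sel false L, e.sign ≠ f.sign
    · obtain ⟨e, he, f, hf, hs⟩ := h2
      have ini : ∀ b, ∀ e ∈ sel b L, ∃ x ∈ sel b L, x.isTerminal = false ∧ x.sign = e.sign := by
        intro b e he
        cases ht : e.isTerminal
        · exact ⟨e, he, ht, rfl⟩
        · exact ⟨mate e, h1 b e he, by simp [ht], rfl⟩
      obtain ⟨x, hx, hxt, hxs⟩ := ini _ e he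
      obtain ⟨y, hy, hyt, hys⟩ := ini _ f hf
      have hs' : y.sign = !x.sign := by
        rw [← hxs, ← hys] at hs
        cases h : x.sign <;> cases h' : y.sign <;> simp_all
      have hxy : x.label ≠ y.label := by
        intro hl
        have := hG.eq_or (e := x) (x := y) (by simpa using mem_of_sel hx) (by simpa using mem_of_sel hy) hl.symm
        rcases this with rfl | rfl <;> simp at hs'
      have hmx := h1 _ x hx
      have hmy := h1 _ y hy
      obtain ⟨l1, w1, a1, b1⟩ := Sw.front' hx
      have hmx1 : mate x ∈ sel false l1 := by
        rw [← b1] at hmx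
        simpa [(ne_mate x).symm] using hmx
      rw [← a1] at hy hmy
      obtain ⟨l2, w2, a2, b2⟩ := Sw.front' hy
      rw [← a2] at hmx1
      have hmy2 : mate y ∈ sel false l2 := by
        rw [← b2] at hmy
        simpa [(ne_mate y).symm] using hmy
      obtain ⟨l3, w3, a3, b3⟩ := Sw.front' hmx1
      rw [← a3] at hmy2
      obtain ⟨l4, w4, a4, b4⟩ := Sw.front' hmy2
      have w : Sw L (x :: y :: mate x :: mate y :: l4) :=
        w1.trans (Sw.cons x (w2.trans (Sw.cons y (w3.trans (Sw.cons _ w4)))))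
      have r1 : Rel2kXi k L (x :: y :: mate x :: mate y :: l4) := w.rel hG
      have hG1 : GaussM ((x :: y :: mate x :: mate y :: l4 : List Endpoint) : Multiset Endpoint) := by
        rw [← w.coe_eq]; exact hG
      have fx := rest_list (x := x) (N := y :: mate y :: l4) hG1
        (mset_eq (by intro a; simp [List.count_cons]; omega))
      have fy := rest_list (x := y) (N := x :: mate x :: l4) hG1
        (mset_eq (by intro a; simp [List.count_cons]; omega))
      have r2 : Rel2kXi k (x :: y :: mate x :: mate y :: l4) l4 := by
        refine rel_of_reid (Or.inr (Or.inr (Or.inr (Or.inl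
          ⟨[], [], l4, x.label, y.label, x.sign, true, hxy, ?_, ?_, ?_, rfl⟩))))
        · intro hm
          obtain ⟨z, hz, e⟩ := List.mem_map.1 hm
          exact fx z (by simp at hz; simp [hz]) e
        · intro hm
          obtain ⟨z, hz, e⟩ := List.mem_map.1 hm
          exact fy z (by simp at hz; simp [hz]) e
        · rw [← hs']
          simp [mate, hxt, hyt]
          constructor
          · rw [← hxt]
          · rw [← hyt]
      have r := rel_trans r1 r2
      have hlen : l4.length + 4 = L.length := by
        have := congrArg Multiset.card w.coe_eq
        simp at this
        omega
      obtain ⟨L', q1, q2, q3⟩ := ih (n - 4) (by omega) l4 (by omega) ((inv_rel r).1.1 hG)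
      exact ⟨L', rel_trans r q1, q2, q3⟩
    · push Not at h2
      refine ⟨L, rel_refl L, hG, h1, ?_⟩
      by_cases hL : L = []
      · subst hL; exact ⟨true, by simp⟩
      · obtain ⟨⟨e0, he0⟩, f0, hf0⟩ := sel_nonempty hG hL
        refine ⟨e0.sign, fun e he => ?_⟩
        rcases mem_sel_or true he with h | h
        · rw [h2 e h f0 hf0, h2 e0 he0 f0 hf0]
        · exact (h2 e0 he0 e h).symm
  · push Not at h1
    obtain ⟨b, e, he, hme⟩ := h1
    have hm : mate e ∈ sel (!b) L :=
      (mem_sel_or b (by simpa using hG.mate_mem (e := e) (by simpa using mem_of_sel he))).resolve_left hme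
    obtain ⟨x, hx, hmx⟩ : ∃ x, x ∈ sel true L ∧ mate x ∈ sel false L := by
      cases b
      · exact ⟨mate e, hm, by simpa using he⟩
      · exact ⟨e, he, hm⟩
    obtain ⟨l1, w1, a1, b1⟩ := Sw.front' hx
    rw [← a1] at hmx
    obtain ⟨l2, w2, a2, b2⟩ := Sw.front' hmx
    have w : Sw L (x :: mate x :: l2) := w1.trans (Sw.cons x w2)
    have r1 : Rel2kXi k L (x :: mate x :: l2) := w.rel hG
    have fx := rest_list (x := x) (N := l2) hG w.coe_eq
    have r2 : Rel2kXi k (x :: mate x :: l2) l2 := rel_r1 (A := []) (by simpa using fx)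
    have r := rel_trans r1 r2
    have hlen : l2.length + 2 = L.length := by
      have := congrArg Multiset.card w.coe_eq
      simp at this
      omega
    obtain ⟨L', q1, q2, q3⟩ := ih (n - 2) (by omega) l2 (by omega) ((inv_rel r).1.1 hG)
    exact ⟨L', rel_trans r q1, q2, q3⟩

/-- The endpoints of chords of sign `s` with the given labels. -/
def cm (s : Bool) : List ℕ → Multiset Endpoint
  | [] => 0
  | c :: l => {⟨c, false, s⟩, ⟨c, true, s⟩} + cm s l

theorem mem_cm {s : Bool} {l : List ℕ} {e : Endpoint} : e ∈ cm s l ↔ e.label ∈ l ∧ e.sign = s := by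
  induction l with
  | nil => simp [cm]
  | cons c l ih =>
    obtain ⟨d, t, s'⟩ := e
    simp only [cm, Multiset.mem_add, ih]
    cases t <;> simp <;> tauto

theorem cm_LD {s : Bool} {c : ℕ} {l : List ℕ} (h : c ∉ l) :
    LD {⟨c, false, s⟩, ⟨c, true, s⟩} (cm s l) := by
  intro x hx y hy e
  have hy := (mem_cm.1 hy).1
  have : x.label = c := by simp at hx; rcases hx with rfl | rfl <;> rfl
  rw [← e, this] at hy
  exact h hy

theorem cm_gauss {s : Bool} {l : List ℕ} (h : l.Nodup) : GaussM (cm s l) := by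
  induction l with
  | nil => simp [cm, GaussM]
  | cons c l ih =>
    rw [List.nodup_cons] at h
    rw [cm, gaussM_add (cm_LD h.1)]
    exact ⟨gaussM_chord ⟨c, false, s⟩, ih h.2⟩

theorem cm_JM {s : Bool} {l : List ℕ} (h : l.Nodup) : JM (cm s l) = l.length * sg s := by
  induction l with
  | nil => simp [cm]
  | cons c l ih =>
    rw [List.nodup_cons] at h
    rw [cm, JM_add (cm_LD h.1), ih h.2]
    have : JM {⟨c, false, s⟩, ⟨c, true, s⟩} = sg s := JM_chord ⟨c, false, s⟩
    rw [this]
    push_cast [List.length_cons]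
    ring

theorem cm_card (s : Bool) (l : List ℕ) : (cm s l).card = 2 * l.length := by
  induction l with
  | nil => simp [cm]
  | cons c l ih =>
    rw [cm, Multiset.card_add, ih]
    simp; ring

theorem cm_map (s : Bool) (l : List ℕ) (f : ℕ → ℕ) : (cm s l).map (rl f) = cm s (l.map f) := by
  induction l with
  | nil => simp [cm]
  | cons c l ih =>
    rw [cm, Multiset.map_add, ih]
    simp [cm, rl]

theorem red_form {L : List Endpoint} (hG : GaussM (L : Multiset Endpoint)) {s : Bool}
    (h1 : ∀ b, ∀ e ∈ sel b L, mate e ∈ sel b L) (h2 : ∀ e ∈ L, e.sign = s) (b : Bool) :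
    ∃ l : List ℕ, l.Nodup ∧ sel b L = cm s l := by
  have hnd : (sel b L).Nodup := by
    have := hG.nodup
    rw [← sel_add b L, Multiset.nodup_add] at this
    exact this.1
  let l : List ℕ := ((sel b L).map Endpoint.label).toFinset.toList
  have hl : l.Nodup := Finset.nodup_toList _
  refine ⟨l, hl, ?_⟩
  rw [Multiset.Nodup.ext hnd (cm_gauss hl).nodup]
  intro e
  rw [mem_cm]
  constructor
  · intro he
    refine ⟨?_, h2 e (mem_of_sel he)⟩
    simp only [l, Finset.mem_toList, Multiset.mem_toFinset, Multiset.mem_map]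
    exact ⟨e, he, rfl⟩
  · rintro ⟨he, hs⟩
    simp only [l, Finset.mem_toList, Multiset.mem_toFinset, Multiset.mem_map] at he
    obtain ⟨x, hx, hl⟩ := he
    have hxs := h2 x (mem_of_sel hx)
    by_cases ht : e.isTerminal = x.isTerminal
    · have : e = x := by cases e; cases x; simp_all
      rw [this]; exact hx
    · have : e = mate x := eq_mate_of hl.symm (by
        cases h : e.isTerminal <;> cases h' : x.isTerminal <;> simp_all) (by rw [hs, hxs])
      rw [this]; exact h1 b x hx

theorem exists_perm_map : ∀ (l l' : List ℕ), l.length = l'.length → l.Nodup → l'.Nodup →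
    ∃ f : ℕ → ℕ, Function.Injective f ∧ l.map f = l' := by
  intro l
  induction l with
  | nil =>
    intro l' h _ _
    have : l' = [] := List.length_eq_zero_iff.1 (by simpa using h.symm)
    exact ⟨id, Function.injective_id, by simp [this]⟩
  | cons a l ih =>
    intro l' h hl hl'
    match l', h with
    | b :: l', h =>
      rw [List.nodup_cons] at hl hl'
      obtain ⟨f, hf, e⟩ := ih l' (by simpa using h) hl.2 hl'.2
      refine ⟨fun x => Equiv.swap (f a) b (f x), (Equiv.injective _).comp hf, ?_⟩
      simp only [List.map_cons, Equiv.swap_apply_left, List.cons.injEq, true_and]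
      rw [← e]
      apply List.map_congr_left
      intro x hx
      apply Equiv.swap_apply_of_ne_of_ne
      · intro h; exact hl.1 (hf h ▸ hx)
      · intro h
        apply hl'.1
        rw [← e, ← h]
        exact List.mem_map_of_mem hx

theorem rel_of_red {k : ℕ} {L L' : List Endpoint} (hG : GaussM (L : Multiset Endpoint))
    (hG' : GaussM (L' : Multiset Endpoint)) (hR : Red L) (hR' : Red L') (hJ : J2 L = J2 L') :
    Rel2kXi k L L' := by
  obtain ⟨h1, s, h2⟩ := hR
  obtain ⟨h1', s', h2'⟩ := hR'
  obtain ⟨lE, nE, eE⟩ := red_form hG h1 h2 true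
  obtain ⟨lO, nO, eO⟩ := red_form hG h1 h2 false
  obtain ⟨lE', nE', eE'⟩ := red_form hG' h1' h2' true
  obtain ⟨lO', nO', eO'⟩ := red_form hG' h1' h2' false
  have c1 := sel_card L
  rw [hG.even, eE, eO, cm_card, cm_card] at c1
  have c2 := sel_card L'
  rw [hG'.even, eE', eO', cm_card, cm_card] at c2
  simp at c1 c2
  rw [J2, J2, eE, eO, eE', eO', cm_JM nE, cm_JM nO, cm_JM nE', cm_JM nO', c1, c2] at hJ
  have key : lO.length = lO'.length ∧ (lO.length = 0 ∨ s = s') := by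
    cases s <;> cases s' <;> simp only [sg, if_true, if_false, Bool.false_eq_true, reduceCtorEq,
      or_true, or_false, and_true] at hJ ⊢ <;> omega
  have nd : ∀ (L : List Endpoint) (s : Bool) (lE lO : List ℕ), GaussM (L : Multiset Endpoint) →
      sel true L = cm s lE → sel false L = cm s lO → lE.Nodup → lO.Nodup → (lE ++ lO).Nodup := by
    intro L s lE lO hG eE eO nE nO
    rw [List.nodup_append]
    refine ⟨nE, nO, ?_⟩
    rintro c hc _ hc' rfl
    have hn := hG.nodup
    rw [← sel_add true L, Multiset.nodup_add] at hn
    have m1 : (⟨c, false, s⟩ : Endpoint) ∈ sel true L := by rw [eE]; exact mem_cm.2 ⟨hc, rfl⟩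
    have m2 : (⟨c, false, s⟩ : Endpoint) ∈ sel (!true) L := by
      rw [Bool.not_true, eO]; exact mem_cm.2 ⟨hc', rfl⟩
    exact Multiset.disjoint_left.1 hn.2.2 m1 m2
  rcases key with ⟨k1, k2 | rfl⟩
  · have z : lE = [] ∧ lO = [] ∧ lE' = [] ∧ lO' = [] := by
      refine ⟨?_, ?_, ?_, ?_⟩ <;> apply List.length_eq_zero_iff.1 <;> omega
    obtain ⟨rfl, rfl, rfl, rfl⟩ := z
    refine Sw.rel (Sw.of_sel ?_) hG
    intro b
    cases b
    · rw [eO, eO']; rfl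
    · rw [eE, eE']; rfl
  · obtain ⟨f, hf, e⟩ := exists_perm_map (lE ++ lO) (lE' ++ lO') (by simp; omega)
      (nd L s lE lO hG eE eO nE nO) (nd L' s lE' lO' hG' eE' eO' nE' nO')
    rw [List.map_append] at e
    obtain ⟨e1, e2⟩ := List.append_inj e (by simp; omega)
    have r1 : Rel2kXi k L (L.map (rl f)) := rel_of_reid (Or.inr (Or.inl ⟨f, hf, rfl⟩))
    refine rel_trans r1 (Sw.rel (Sw.of_sel ?_) ((inv_rel r1).1.1 hG))
    intro b
    rw [sel_map]
    cases b
    · rw [eO, eO', cm_map, e2]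
    · rw [eE, eE', cm_map, e1]

/-- J2 is invariant under Reidemeister and Ξ-moves: use the invariance for all moduli. -/
theorem reduce_J2 (k : ℕ) {L : List Endpoint} (hG : GaussM (L : Multiset Endpoint)) :
    ∃ L', Rel2kXi k L L' ∧ GaussM (L' : Multiset Endpoint) ∧ Red L' ∧ J2 L = J2 L' := by
  obtain ⟨L', h1, h2, h3⟩ := reduce 0 L.length L le_rfl hG
  refine ⟨L', ?_, h2, h3, ?_⟩
  · have tr : ∀ {L L' : List Endpoint}, move2k 0 L L' → L = L' := by
      rintro L L' ⟨A, B, C, c, s, -, -, rfl, rfl⟩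
      simp
    have st : ∀ {L L' : List Endpoint}, (reidStep L L' ∨ move2k 0 L L' ∨ xiStep L L') →
        Rel2kXi k L L' := by
      rintro L L' (h | h | h)
      · exact rel_of_reid h
      · rw [tr h]; exact rel_refl _
      · exact Relation.ReflTransGen.single (Or.inl (Or.inr (Or.inr h)))
    clear h2 h3
    induction h1 with
    | refl => exact rel_refl _
    | tail _ h ih => exact rel_trans ih (h.elim st (fun h => rel_symm (st h)))
  · have := (inv_rel h1).2 hG
    simpa [Int.ModEq] using this

theorem rel_of_J2_eq {k : ℕ} {L L' : List Endpoint} (hG : GaussM (L : Multiset Endpoint))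
    (hG' : GaussM (L' : Multiset Endpoint)) (hJ : J2 L = J2 L') : Rel2kXi k L L' := by
  obtain ⟨M, a1, a2, a3, a4⟩ := reduce_J2 k hG
  obtain ⟨M', b1, b2, b3, b4⟩ := reduce_J2 k hG'
  exact rel_trans a1 (rel_trans (rel_of_red a2 b2 a3 b3 (by rw [← a4, ← b4, hJ])) (rel_symm b1))

theorem addMoves {k : ℕ} (s : Bool) (n : ℕ) {L : List Endpoint} (hG : GaussM (L : Multiset Endpoint)) :
    ∃ L', Rel2kXi k L L' ∧ GaussM (L' : Multiset Endpoint) ∧ J2 L' = J2 L + n * (2 * k * sg s) := by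
  induction n with
  | zero => exact ⟨L, rel_refl L, hG, by simp⟩
  | succ n ih =>
    obtain ⟨M, h1, h2, h3⟩ := ih
    obtain ⟨N, hN⟩ := exists_fresh M
    have hl : ∀ i < 2 * k, (fun i => N + i) i ∉ labels ([] ++ [] ++ M) := by
      intro i _ hm
      obtain ⟨z, hz, e⟩ := List.mem_map.1 hm
      have := hN z (by simpa using hz)
      simp at e
      omega
    have hc : ∀ i < 2 * k, ∀ j < 2 * k, (fun i => N + i) i = (fun i => N + i) j → i = j := by
      intro i _ j _ h
      simpa using h
    obtain ⟨q1, q2⟩ := move2k_main [] [] M (fun i => N + i) s hc hl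
    refine ⟨_, rel_trans h1 (Relation.ReflTransGen.single (Or.inr (Or.inr (Or.inl
      ⟨[], [], M, fun i => N + i, s, hc, hl, rfl, rfl⟩)))), q1.2 h2, ?_⟩
    refine q2.trans ?_
    simp only [odd_nil, Bool.false_eq_true, if_false, List.nil_append]
    rw [h3]
    push_cast
    ring

theorem rel_of_J2 {k : ℕ} {L L' : List Endpoint} (hG : GaussM (L : Multiset Endpoint))
    (hG' : GaussM (L' : Multiset Endpoint)) (hJ : J2 L ≡ J2 L' [ZMOD (2 * k : ℤ)]) :
    Rel2kXi k L L' := by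
  obtain ⟨m, hm⟩ := Int.modEq_iff_dvd.1 hJ
  obtain ⟨M, h1, h2, h3⟩ := addMoves (k := k) (decide (0 ≤ m)) m.natAbs hG
  refine rel_trans h1 (rel_of_J2_eq h2 hG' ?_)
  rw [h3]
  have : (m.natAbs : ℤ) * sg (decide (0 ≤ m)) = m := by
    by_cases h : 0 ≤ m
    · simp [sg, h]
    · simp only [sg, h, decide_false, Bool.false_eq_true, if_false]
      omega
  calc _ = J2 L + 2 * k * (m.natAbs * sg (decide (0 ≤ m))) := by ring
    _ = J2 L' := by rw [this, ← hm]; ring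

end Gauss

open Gauss in
/-- for k ≥ 1, two virtual knots have congruent odd writhes mod 2k
iff they are related by a finite sequence of 2k-moves and Ξ-moves
(and Reidemeister moves). -/
theorem oddWrithe_modEq_iff_rel2kXi (k : ℕ) (hk : 0 < k)
    (G G' : List Endpoint) (hG : IsGaussDiagram G) (hG' : IsGaussDiagram G') :
    oddWrithe G ≡ oddWrithe G' [ZMOD (2 * k : ℤ)] ↔ Rel2kXi k G G' := by
  rw [gauss_iff] at hG hG'
  rw [oddWrithe_eq hG, oddWrithe_eq hG']
  exact ⟨fun h => rel_of_J2 hG hG' h, fun h => (inv_rel h).2 hG⟩
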